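/- For any matrices X, Y ∈ ℝ^{m×n} with m ≤ n, ‖Y − X‖_F² ≥ Σ_{i=1}^{m} (σ_i(Y) − σ_i(X))², where ‖·‖_F denotes the Frobenius norm and σ_i(·) denotes the i-th largest singular value. -/

import Mathlib

noncomputable section

open Matrix

/-- The singular values of a real matrix (square roots of the eigenvalues of `X * Xᵀ`),
arranged in descending order. -/
def sval {m n : ℕ} (X : Matrix (Fin m) (Fin n) ℝ) (i : Fin m) : ℝ :=
  ((List.ofFn fun j : Fin m =>
      Real.sqrt ((Matrix.isHermitian_mul_conjTranspose_self X).eigenvalues j)).mergeSort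
      (fun x y => decide (y ≤ x)))[(i : ℕ)]'(by simp)

/-- The squared Frobenius norm. -/
def frobSq {m n : ℕ} (X : Matrix (Fin m) (Fin n) ℝ) : ℝ := ∑ i, ∑ j, (X i j) ^ 2

theorem exists_perm_antitone_mergeSort {m : ℕ} (f : Fin m → ℝ) :
    ∃ e : Equiv.Perm (Fin m), Antitone (f ∘ e) ∧
      (List.ofFn f).mergeSort (fun x y => decide (y ≤ x)) = List.ofFn (f ∘ e) := by
  have hanti : Antitone (f ∘ Tuple.sort (-f)) := by
    intro i j hij
    simpa using Tuple.monotone_sort (-f) hij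
  exact ⟨Tuple.sort (-f), hanti, List.Perm.eq_of_pairwise (le := fun x y : ℝ => y ≤ x)
    (fun a b _ _ h₁ h₂ => le_antisymm h₂ h₁)
    (List.pairwise_mergeSort' (fun x y : ℝ => y ≤ x) _) hanti.sortedGE_ofFn.pairwise
    ((List.mergeSort_perm _ _).trans (Equiv.Perm.ofFn_comp_perm _ _).symm)⟩

theorem exists_perm_sval {m n : ℕ} (X : Matrix (Fin m) (Fin n) ℝ) :
    ∃ e : Equiv.Perm (Fin m), Antitone (sval X) ∧ ∀ i, sval X i =
      √((isHermitian_mul_conjTranspose_self X).eigenvalues (e i)) := by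
  obtain ⟨e, hanti, he⟩ := exists_perm_antitone_mergeSort fun j =>
    √((isHermitian_mul_conjTranspose_self X).eigenvalues j)
  have h : ∀ i, sval X i = √((isHermitian_mul_conjTranspose_self X).eigenvalues (e i)) := by
    intro i
    rw [sval, List.getElem_of_eq he, List.getElem_ofFn]
    rfl
  refine ⟨e, fun i j hij => ?_, h⟩
  rw [h, h]
  exact hanti hij

theorem sval_antitone {m n : ℕ} (X : Matrix (Fin m) (Fin n) ℝ) : Antitone (sval X) :=
  (exists_perm_sval X).choose_spec.1

theorem sval_nonneg {m n : ℕ} (X : Matrix (Fin m) (Fin n) ℝ) (i : Fin m) : 0 ≤ sval X i := by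
  obtain ⟨e, -, he⟩ := exists_perm_sval X
  rw [he]
  positivity

theorem exists_orthogonal_diagonalization {m n : ℕ} (X : Matrix (Fin m) (Fin n) ℝ) :
    ∃ U : Matrix (Fin m) (Fin m) ℝ, Uᵀ * U = 1 ∧
      Uᵀ * (X * Xᵀ) * U = diagonal fun i => sval X i ^ 2 := by
  obtain ⟨e, -, he⟩ := exists_perm_sval X
  have hX := isHermitian_mul_conjTranspose_self X
  have hpos := (posSemidef_self_mul_conjTranspose X).eigenvalues_nonneg
  have hU : star (hX.eigenvectorUnitary : Matrix (Fin m) (Fin m) ℝ) *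
      (hX.eigenvectorUnitary : Matrix (Fin m) (Fin m) ℝ) = 1 := Unitary.coe_star_mul_self _
  have hD := hX.conjStarAlgAut_star_eigenvectorUnitary
  rw [Unitary.conjStarAlgAut_star_apply] at hD
  rw [star_eq_conjTranspose, conjTranspose_eq_transpose_of_trivial] at hU hD
  set W := (hX.eigenvectorUnitary : Matrix (Fin m) (Fin m) ℝ)
  replace hD : Wᵀ * (X * Xᵀ) * W = diagonal (RCLike.ofReal ∘ hX.eigenvalues) := hD
  refine ⟨W.submatrix id e, ?_, ?_⟩
  · calc _ = (Wᵀ * W).submatrix e e := by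
          rw [submatrix_mul _ _ e id e Function.bijective_id]; rfl
      _ = 1 := by rw [hU, submatrix_one_equiv]
  · calc _ = (Wᵀ * (X * Xᵀ) * W).submatrix e e := by
          rw [submatrix_mul _ _ e id e Function.bijective_id,
            submatrix_mul _ _ e id id Function.bijective_id]; rfl
      _ = _ := by
          rw [hD, submatrix_diagonal_equiv]
          congr 1
          ext i
          rw [he]
          exact (Real.sq_sqrt (hpos (e i))).symm

/-- A singular value decomposition in which the right singular vectors belonging to the singular
value zero are taken to be zero. -/
theorem exists_eq_mul_diagonal_sval_mul {m n : ℕ} (X : Matrix (Fin m) (Fin n) ℝ) :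
    ∃ (U : Matrix (Fin m) (Fin m) ℝ) (V : Matrix (Fin n) (Fin m) ℝ) (d : Fin m → ℝ),
      Uᵀ * U = 1 ∧ Vᵀ * V = diagonal d ∧ (∀ i, d i ≤ 1) ∧
      X = U * diagonal (sval X) * Vᵀ := by
  obtain ⟨U, hU, hD⟩ := exists_orthogonal_diagonalization X
  have hU' : U * Uᵀ = 1 := mul_eq_one_comm.mp hU
  set σ := sval X
  have hM : (Uᵀ * X) * (Uᵀ * X)ᵀ = diagonal fun i => σ i ^ 2 := by
    rw [← hD]; simp [Matrix.mul_assoc]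
  have hproj : diagonal σ * diagonal σ⁻¹ * (Uᵀ * X) = Uᵀ * X := by
    ext i j
    rw [diagonal_mul_diagonal, diagonal_mul]
    by_cases h : σ i = 0
    · have hi := congr_fun (congr_fun hM i) i
      rw [mul_apply, diagonal_apply_eq, h] at hi
      have := (Finset.sum_eq_zero_iff_of_nonneg
        (fun k _ => mul_self_nonneg ((Uᵀ * X) i k))).mp (by simpa using hi) j (Finset.mem_univ j)
      simp [mul_self_eq_zero.mp this]
    · simp [h]
  refine ⟨U, (Uᵀ * X)ᵀ * diagonal σ⁻¹, fun i => σ i * (σ i)⁻¹, hU, ?_, fun i => mul_inv_le_one,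
    ?_⟩
  · calc _ = diagonal σ⁻¹ * ((Uᵀ * X) * (Uᵀ * X)ᵀ) * diagonal σ⁻¹ := by simp [Matrix.mul_assoc]
      _ = _ := by
        rw [hM, diagonal_mul_diagonal, diagonal_mul_diagonal]
        congr 1
        ext i
        by_cases h : σ i = 0
        · simp [h]
        · simp only [Pi.inv_apply]; field_simp
  · calc X = U * (Uᵀ * X) := by rw [← Matrix.mul_assoc, hU', Matrix.one_mul]
      _ = U * (diagonal σ * diagonal σ⁻¹ * (Uᵀ * X)) := by rw [hproj]
      _ = _ := by simp [Matrix.mul_assoc, -diagonal_mul_diagonal]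

theorem frobSq_eq_trace {m n : ℕ} (X : Matrix (Fin m) (Fin n) ℝ) :
    frobSq X = (X * Xᵀ).trace := by
  simp [frobSq, trace, mul_apply, sq]

theorem frobSq_eq_sum_sval_sq {m n : ℕ} (X : Matrix (Fin m) (Fin n) ℝ) :
    frobSq X = ∑ i, sval X i ^ 2 := by
  obtain ⟨U, hU, hD⟩ := exists_orthogonal_diagonalization X
  rw [← trace_diagonal, ← hD, Matrix.mul_assoc, trace_mul_comm, Matrix.mul_assoc,
    mul_eq_one_comm.mp hU, Matrix.mul_one, frobSq_eq_trace]

/-- Bessel's inequality for the columns of a matrix. -/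
theorem sum_transpose_mulVec_sq_le {ι κ : Type*} [Fintype ι] [Fintype κ] [DecidableEq κ]
    {V : Matrix ι κ ℝ} {d : κ → ℝ} (hV : Vᵀ * V = diagonal d) (hd : ∀ i, d i ≤ 1) (z : ι → ℝ) :
    ∑ i, (Vᵀ *ᵥ z) i ^ 2 ≤ z ⬝ᵥ z := by
  set c := Vᵀ *ᵥ z with hc
  have h₁ : z ⬝ᵥ V *ᵥ c = c ⬝ᵥ c := by rw [dotProduct_mulVec, ← mulVec_transpose]
  have h₂ : V *ᵥ c ⬝ᵥ V *ᵥ c = ∑ i, d i * c i ^ 2 := by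
    rw [dotProduct_mulVec, ← mulVec_transpose, mulVec_mulVec, hV, dotProduct]
    exact Finset.sum_congr rfl fun i _ => by rw [mulVec_diagonal]; ring
  have h₃ : ∑ i, d i * c i ^ 2 ≤ ∑ i, c i ^ 2 :=
    Finset.sum_le_sum fun i _ => mul_le_of_le_one_left (sq_nonneg _) (hd i)
  have h₄ : c ⬝ᵥ c = ∑ i, c i ^ 2 := by simp [dotProduct, sq]
  have h₅ : 0 ≤ (z - V *ᵥ c) ⬝ᵥ (z - V *ᵥ c) :=
    Finset.sum_nonneg fun i _ => mul_self_nonneg _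
  rw [dotProduct_sub, sub_dotProduct, sub_dotProduct, dotProduct_comm (V *ᵥ c) z, h₁, h₂, h₄] at h₅
  linarith

theorem sum_transpose_mul_sq_le_one {ι κ μ : Type*} [Fintype ι] [Fintype κ] [Fintype μ]
    [DecidableEq κ] [DecidableEq μ] {V : Matrix ι κ ℝ} {Z : Matrix ι μ ℝ} {d : κ → ℝ} {c : μ → ℝ}
    (hV : Vᵀ * V = diagonal d) (hd : ∀ i, d i ≤ 1) (hZ : Zᵀ * Z = diagonal c)
    (hc : ∀ j, c j ≤ 1) (j : μ) : ∑ i, (Vᵀ * Z) i j ^ 2 ≤ 1 := by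
  refine (sum_transpose_mulVec_sq_le hV hd (Z.col j)).trans ?_
  have h := congr_fun (congr_fun hZ j) j
  rw [diagonal_apply_eq] at h
  exact h.le.trans (hc j)

theorem sum_range_sub_mul_bounds {a b : ℕ → ℝ} (ha : Antitone a) (hb : Antitone b) {i j : ℕ}
    (hij : i ≤ j) :
    (a i - a j) * b j ≤ ∑ k ∈ Finset.range j, (a k - a (k + 1)) * b k -
        ∑ k ∈ Finset.range i, (a k - a (k + 1)) * b k ∧
      ∑ k ∈ Finset.range j, (a k - a (k + 1)) * b k -
        ∑ k ∈ Finset.range i, (a k - a (k + 1)) * b k ≤ (a i - a j) * b i := by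
  induction j, hij using Nat.le_induction with
  | base => simp
  | succ j hij ih =>
    rw [Finset.sum_range_succ]
    have h₁ := ha hij
    have h₂ := ha j.le_succ
    have h₃ := hb hij
    have h₄ := hb j.le_succ
    constructor
    · nlinarith [mul_nonneg (sub_nonneg.2 (h₂.trans h₁)) (sub_nonneg.2 h₄)]
    · nlinarith [mul_nonneg (sub_nonneg.2 h₂) (sub_nonneg.2 h₃)]

/-- Optimal dual potentials for the assignment problem with product weights. -/
theorem exists_potentials {m : ℕ} {a b : Fin m → ℝ} (ha : Antitone a) (hb : Antitone b)
    (ha₀ : ∀ i, 0 ≤ a i) (hb₀ : ∀ i, 0 ≤ b i) :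
    ∃ p q : Fin m → ℝ, (∀ i, 0 ≤ p i) ∧ (∀ i, 0 ≤ q i) ∧ (∀ i, p i + q i = a i * b i) ∧
      ∀ i j, a i * b j ≤ p i + q j := by
  have extend : ∀ {f : Fin m → ℝ}, Antitone f → (∀ i, 0 ≤ f i) →
      Antitone fun k : ℕ => if h : k < m then f ⟨k, h⟩ else 0 := by
    intro f hf hf₀ k l hkl
    dsimp only
    split_ifs with h₁ h₂ h₂
    · exact hf hkl
    · omega
    · exact hf₀ _
    · exact le_rfl
  set a' : ℕ → ℝ := fun k => if h : k < m then a ⟨k, h⟩ else 0 with ha'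
  set b' : ℕ → ℝ := fun k => if h : k < m then b ⟨k, h⟩ else 0 with hb'
  have hA : ∀ i : Fin m, a' i = a i := fun i => by simp [ha']
  have hB : ∀ i : Fin m, b' i = b i := fun i => by simp [hb']
  have hm : a' m = 0 := by simp [ha']
  have hm' : b' m = 0 := by simp [hb']
  have key := fun {i j : ℕ} (hij : i ≤ j) =>
    sum_range_sub_mul_bounds (extend ha ha₀) (extend hb hb₀) hij
  set P : ℕ → ℝ := fun j => ∑ k ∈ Finset.range j, (a' k - a' (k + 1)) * b' k
  refine ⟨fun i => P m - P i, fun i => a i * b i - (P m - P i), fun i => ?_, fun i => ?_,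
    fun i => by ring, fun i j => ?_⟩
  · have h := (key i.is_lt.le).1
    change (a' i - a' m) * b' m ≤ P m - P i at h
    simpa [hm'] using h
  · have h := (key i.is_lt.le).2
    change P m - P i ≤ (a' i - a' m) * b' i at h
    rw [hm, hA, hB] at h
    linarith
  · rcases le_total i j with hij | hij
    · have h := (key (Fin.le_def.mp hij)).1
      change (a' i - a' j) * b' j ≤ P j - P i at h
      rw [hA, hA, hB] at h
      linarith
    · have h := (key (Fin.le_def.mp hij)).2
      change P i - P j ≤ (a' j - a' i) * b' j at h
      rw [hA, hA, hB] at h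
      linarith

/-- The rearrangement inequality for doubly substochastic weights. -/
theorem sum_mul_mul_le_of_substochastic {m : ℕ} {a b : Fin m → ℝ} (ha : Antitone a)
    (hb : Antitone b) (ha₀ : ∀ i, 0 ≤ a i) (hb₀ : ∀ i, 0 ≤ b i) {S : Fin m → Fin m → ℝ}
    (hS : ∀ i j, 0 ≤ S i j) (hrow : ∀ i, ∑ j, S i j ≤ 1) (hcol : ∀ j, ∑ i, S i j ≤ 1) :
    ∑ i, ∑ j, a i * b j * S i j ≤ ∑ i, a i * b i := by
  obtain ⟨p, q, hp, hq, hpq, hle⟩ := exists_potentials ha hb ha₀ hb₀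
  calc ∑ i, ∑ j, a i * b j * S i j
      ≤ ∑ i, ∑ j, (p i + q j) * S i j :=
        Finset.sum_le_sum fun i _ => Finset.sum_le_sum fun j _ =>
          mul_le_mul_of_nonneg_right (hle i j) (hS i j)
    _ = ∑ i, p i * ∑ j, S i j + ∑ j, q j * ∑ i, S i j := by
        simp_rw [add_mul, Finset.sum_add_distrib, Finset.mul_sum]
        congr 1
        exact Finset.sum_comm
    _ ≤ ∑ i, p i + ∑ j, q j :=
        add_le_add
          (Finset.sum_le_sum fun i _ => mul_le_of_le_one_right (hp i) (hrow i))
          (Finset.sum_le_sum fun j _ => mul_le_of_le_one_right (hq j) (hcol j))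
    _ = ∑ i, a i * b i := by simp_rw [← Finset.sum_add_distrib, hpq]

/-- **Von Neumann's trace inequality**. -/
theorem trace_mul_transpose_le_sum_sval_mul_sval {m n : ℕ} (X Y : Matrix (Fin m) (Fin n) ℝ) :
    (X * Yᵀ).trace ≤ ∑ i, sval X i * sval Y i := by
  obtain ⟨U, V, d, hU, hV, hd, hX⟩ := exists_eq_mul_diagonal_sval_mul X
  obtain ⟨W, Z, c, hW, hZ, hc, hY⟩ := exists_eq_mul_diagonal_sval_mul Y
  have hUd : Uᵀ * U = diagonal fun _ => 1 := by rw [hU, diagonal_one]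
  have hWd : Wᵀ * W = diagonal fun _ => 1 := by rw [hW, diagonal_one]
  have hone : ∀ _ : Fin m, (1 : ℝ) ≤ 1 := fun _ => le_rfl
  have swap : ∀ {k : ℕ} (A B : Matrix (Fin k) (Fin m) ℝ) (i j : Fin m),
      (Aᵀ * B) i j = (Bᵀ * A) j i := fun A B i j => by
    rw [← transpose_apply (Bᵀ * A), transpose_mul, transpose_transpose]
  have htrace : (X * Yᵀ).trace =
      ∑ i, ∑ j, sval X i * sval Y j * ((Uᵀ * W) i j * (Vᵀ * Z) i j) := by
    calc (X * Yᵀ).trace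
        = (U * diagonal (sval X) * Vᵀ * (W * diagonal (sval Y) * Zᵀ)ᵀ).trace := by
          rw [← hX, ← hY]
      _ = (U * (diagonal (sval X) * (Vᵀ * Z) * diagonal (sval Y) * Wᵀ)).trace := by
          simp [Matrix.mul_assoc]
      _ = (diagonal (sval X) * (Vᵀ * Z) * diagonal (sval Y) * (Uᵀ * W)ᵀ).trace := by
          rw [trace_mul_comm, Matrix.mul_assoc, transpose_mul, transpose_transpose]
      _ = _ := by
          simp only [trace, diag_apply]
          refine Finset.sum_congr rfl fun i _ => ?_
          rw [mul_apply]
          refine Finset.sum_congr rfl fun j _ => ?_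
          rw [mul_diagonal, diagonal_mul, transpose_apply]
          ring
  have hrow : ∀ i, ∑ j, ((Uᵀ * W) i j ^ 2 + (Vᵀ * Z) i j ^ 2) / 2 ≤ 1 := by
    intro i
    have h₁ := sum_transpose_mul_sq_le_one hWd hone hUd hone i
    have h₂ := sum_transpose_mul_sq_le_one hZ hc hV hd i
    simp_rw [swap W U _ i] at h₁
    simp_rw [swap Z V _ i] at h₂
    rw [← Finset.sum_div, Finset.sum_add_distrib]
    linarith
  have hcol : ∀ j, ∑ i, ((Uᵀ * W) i j ^ 2 + (Vᵀ * Z) i j ^ 2) / 2 ≤ 1 := by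
    intro j
    have h₁ := sum_transpose_mul_sq_le_one hUd hone hWd hone j
    have h₂ := sum_transpose_mul_sq_le_one hV hd hZ hc j
    rw [← Finset.sum_div, Finset.sum_add_distrib]
    linarith
  rw [htrace]
  refine le_trans (Finset.sum_le_sum fun i _ => Finset.sum_le_sum fun j _ =>
    mul_le_mul_of_nonneg_left ?_ (mul_nonneg (sval_nonneg X i) (sval_nonneg Y j)))
    (sum_mul_mul_le_of_substochastic (sval_antitone X) (sval_antitone Y) (sval_nonneg X)
      (sval_nonneg Y) (S := fun i j => ((Uᵀ * W) i j ^ 2 + (Vᵀ * Z) i j ^ 2) / 2)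
      (fun i j => by positivity) hrow hcol)
  linarith [two_mul_le_add_sq ((Uᵀ * W) i j) ((Vᵀ * Z) i j)]

/-- For `X, Y ∈ ℝ^{m×n}` with `m ≤ n`, `‖Y − X‖_F² ≥ Σ_{i=1}^m (σ_i(Y) − σ_i(X))²`. -/
theorem frobSq_sub_ge_sum_sval_sub_sq {m n : ℕ} (hmn : m ≤ n)
    (X Y : Matrix (Fin m) (Fin n) ℝ) :
    frobSq (Y - X) ≥ ∑ i, (sval Y i - sval X i) ^ 2 := by
  have h : frobSq (Y - X) = frobSq Y - 2 * (Y * Xᵀ).trace + frobSq X := by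
    simp only [frobSq_eq_trace, transpose_sub, Matrix.mul_sub, Matrix.sub_mul, trace_sub]
    rw [← trace_transpose (X * Yᵀ), transpose_mul, transpose_transpose]
    ring
  have hs : ∑ i, (sval Y i - sval X i) ^ 2 =
      ∑ i, sval Y i ^ 2 - 2 * ∑ i, sval Y i * sval X i + ∑ i, sval X i ^ 2 := by
    simp_rw [sub_sq, Finset.sum_add_distrib, Finset.sum_sub_distrib, Finset.mul_sum, mul_assoc]
  rw [ge_iff_le, h, hs, ← frobSq_eq_sum_sval_sq, ← frobSq_eq_sum_sval_sq]
  linarith [trace_mul_transpose_le_sum_sval_mul_sval Y X]
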